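/- (Approximation transfer through coresets.) Let (X̃,Ω̃) be an (ε,δ)-coreset for (k,X,Ω,K) with extension g, let S be any set of k sites, and let C̃ ∈ C_K(k,X̃,Ω̃) be a clustering minimizing cost_{𝒜,S}(X̃,·) over C_K(k,X̃,Ω̃). Then cost_{𝒜,S}(X, g(C̃)) ≤ (δ(1+ε)/(1−ε)) · cost_{𝒜,S}(X); in particular, for an ε-coreset (δ = 1), cost_{𝒜,S}(X, g(C̃)) ≤ ((1+ε)/(1−ε)) · cost_{𝒜,S}(X). -/

import Mathlib

open Matrix BigOperators

/-- The ellipsoidal norm `‖x‖_A := √(xᵀAx)`. -/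
noncomputable def ellipNorm {d : ℕ} (A : Matrix (Fin d) (Fin d) ℝ) (x : Fin d → ℝ) : ℝ :=
  Real.sqrt (x ⬝ᵥ A.mulVec x)

/-- A weight-constrained clustering of a weighted data set indexed by `ι`
(the set of all of them is `C_K(k,X,Ω)`). -/
def IsClustering {k : ℕ} {ι : Type*} [Fintype ι]
    (ω : ι → ℝ) (κ : Fin k → ℝ) (ξ : Fin k → ι → ℝ) : Prop :=
  (∀ i j, 0 ≤ ξ i j) ∧ (∀ j, ∑ i, ξ i j = 1) ∧ (∀ i, ∑ j, ξ i j * ω j = κ i)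

/-- The cost `cost_{𝒜,S}(X,C) = Σ_i Σ_j ξ_{ij} ω_j ‖x_j − s_i‖_{A_i}²`. -/
noncomputable def clusterCost {d k : ℕ} {ι : Type*} [Fintype ι]
    (A : Fin k → Matrix (Fin d) (Fin d) ℝ) (s : Fin k → Fin d → ℝ)
    (x : ι → Fin d → ℝ) (ω : ι → ℝ) (ξ : Fin k → ι → ℝ) : ℝ :=
  ∑ i, ∑ j, ξ i j * ω j * ellipNorm (A i) (x j - s i) ^ 2

/-- `cost_{𝒜,S}(X)`: the optimal value of the cost over `C_K(k,X,Ω)`. -/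
noncomputable def minClusterCost {d k : ℕ} {ι : Type*} [Fintype ι]
    (A : Fin k → Matrix (Fin d) (Fin d) ℝ) (s : Fin k → Fin d → ℝ)
    (x : ι → Fin d → ℝ) (ω : ι → ℝ) (κ : Fin k → ℝ) : ℝ :=
  sInf {c : ℝ | ∃ ξ : Fin k → ι → ℝ, IsClustering ω κ ξ ∧ clusterCost A s x ω ξ = c}

/-- `(X̃,Ω̃)` (indexed by `ι'`) is an `(ε,δ)`-coreset for `(k,X,Ω,K)` (with `𝒜` fixed),
witnessed by the extension `g` and offsets `Δ⁺, Δ⁻`: `g` maps clusterings of the coreset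
to clusterings of the original data, `0 ≤ Δ⁺ ≤ δ·Δ⁻`, and for all sets `S` of `k` sites
and all coreset clusterings `C̃`:
(a) `(1−ε)·cost(X, g(C̃)) ≤ cost(X̃, C̃) + Δ⁺`, and
(b) `cost(X̃) + Δ⁻ ≤ (1+ε)·cost(X)`. -/
def IsCoreset {d k : ℕ} {ι ι' : Type*} [Fintype ι] [Fintype ι'] (ε δ : ℝ)
    (A : Fin k → Matrix (Fin d) (Fin d) ℝ)
    (x : ι → Fin d → ℝ) (ω : ι → ℝ) (κ : Fin k → ℝ)
    (xt : ι' → Fin d → ℝ) (ωt : ι' → ℝ)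
    (g : (Fin k → ι' → ℝ) → (Fin k → ι → ℝ)) (Δp Δm : ℝ) : Prop :=
  (∀ ξ : Fin k → ι' → ℝ, IsClustering ωt κ ξ → IsClustering ω κ (g ξ)) ∧
  0 ≤ Δp ∧ Δp ≤ δ * Δm ∧
  ∀ s : Fin k → Fin d → ℝ,
    (∀ ξ : Fin k → ι' → ℝ, IsClustering ωt κ ξ →
      (1 - ε) * clusterCost A s x ω (g ξ) ≤ clusterCost A s xt ωt ξ + Δp) ∧
    minClusterCost A s xt ωt κ + Δm ≤ (1 + ε) * minClusterCost A s x ω κ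

/-- The cost of a clustering with nonnegative weights is nonnegative. -/
theorem IsClustering.clusterCost_nonneg {d k : ℕ} {ι : Type*} [Fintype ι]
    {ω : ι → ℝ} {κ : Fin k → ℝ} {ξ : Fin k → ι → ℝ} (hξ : IsClustering ω κ ξ)
    (hω : ∀ j, 0 ≤ ω j) (A : Fin k → Matrix (Fin d) (Fin d) ℝ) (s : Fin k → Fin d → ℝ)
    (x : ι → Fin d → ℝ) : 0 ≤ clusterCost A s x ω ξ :=
  Finset.sum_nonneg fun i _ => Finset.sum_nonneg fun j _ =>
    mul_nonneg (mul_nonneg (hξ.1 i j) (hω j)) (sq_nonneg _)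

/-- A minimizing clustering attains the optimal value. -/
theorem IsClustering.minClusterCost_eq {d k : ℕ} {ι : Type*} [Fintype ι]
    {ω : ι → ℝ} {κ : Fin k → ℝ} {ξ : Fin k → ι → ℝ} (hξ : IsClustering ω κ ξ)
    {A : Fin k → Matrix (Fin d) (Fin d) ℝ} {s : Fin k → Fin d → ℝ} {x : ι → Fin d → ℝ}
    (hmin : ∀ η : Fin k → ι → ℝ, IsClustering ω κ η →
      clusterCost A s x ω ξ ≤ clusterCost A s x ω η) :
    minClusterCost A s x ω κ = clusterCost A s x ω ξ := by
  refine IsLeast.csInf_eq ⟨⟨ξ, hξ, rfl⟩, ?_⟩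
  rintro _ ⟨η, hη, rfl⟩
  exact hmin η hη

/-- (Approximation transfer through coresets.)  If `(X̃,Ω̃)` is an `(ε,δ)`-coreset for
`(k,X,Ω,K)` with extension `g`, `S` is any set of `k` sites, and `C̃` minimizes
`cost_{𝒜,S}(X̃,·)` over `C_K(k,X̃,Ω̃)`, then
`cost_{𝒜,S}(X, g(C̃)) ≤ (δ(1+ε)/(1−ε))·cost_{𝒜,S}(X)`
(in particular, for `δ = 1`, the factor is `(1+ε)/(1−ε)`). -/
theorem coreset_approximation_transfer {d k : ℕ} {ι ι' : Type*} [Fintype ι] [Fintype ι']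
    (ε δ : ℝ) (hε0 : 0 < ε) (hε : ε ≤ 1/2) (hδ : 1 ≤ δ)
    (A : Fin k → Matrix (Fin d) (Fin d) ℝ) (hA : ∀ i, (A i).PosDef)
    (x : ι → Fin d → ℝ) (ω : ι → ℝ) (hω : ∀ j, 0 < ω j) (κ : Fin k → ℝ)
    (xt : ι' → Fin d → ℝ) (ωt : ι' → ℝ) (hωt : ∀ j, 0 < ωt j)
    (g : (Fin k → ι' → ℝ) → (Fin k → ι → ℝ)) (Δp Δm : ℝ)
    (hcs : IsCoreset ε δ A x ω κ xt ωt g Δp Δm)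
    (s : Fin k → Fin d → ℝ)
    (ξt : Fin k → ι' → ℝ) (hfeas : IsClustering ωt κ ξt)
    (hmin : ∀ ξ : Fin k → ι' → ℝ, IsClustering ωt κ ξ →
      clusterCost A s xt ωt ξt ≤ clusterCost A s xt ωt ξ) :
    clusterCost A s x ω (g ξt) ≤ δ * (1 + ε) / (1 - ε) * minClusterCost A s x ω κ := by
  obtain ⟨-, -, hΔ, hcost⟩ := hcs
  obtain ⟨hupper, hlower⟩ := hcost s
  have hext := hupper ξt hfeas
  rw [hfeas.minClusterCost_eq hmin] at hlower
  have hnonneg := hfeas.clusterCost_nonneg (fun j => (hωt j).le) A s xt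
  rw [div_mul_eq_mul_div, le_div_iff₀ (by linarith)]
  calc clusterCost A s x ω (g ξt) * (1 - ε)
      ≤ clusterCost A s xt ωt ξt + Δp := by linarith
    _ ≤ δ * clusterCost A s xt ωt ξt + δ * Δm :=
        add_le_add (le_mul_of_one_le_left hnonneg hδ) hΔ
    _ = δ * (clusterCost A s xt ωt ξt + Δm) := by ring
    _ ≤ δ * ((1 + ε) * minClusterCost A s x ω κ) :=
        mul_le_mul_of_nonneg_left hlower (by linarith)
    _ = δ * (1 + ε) * minClusterCost A s x ω κ := by ring
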